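/- arXiv:1303.5578 — 4 statements merged into one kernel-verified Lean document; each statement's English description precedes it below -/
import Mathlib

section
/- Let m ≥ 3 be an integer and let a, a_1, …, a_9 be integers satisfying a_1² + ⋯ + a_9² = a² + m and a_1 + ⋯ + a_9 = 3a + m − 2. Assume a ≥ 0, and assume that if a = 0 then a_i ≤ 0 for every i. Then m ≤ 9. (This is part (i) of the paper's lemma on (−m)-curves: a (−m)-curve D = a·h − Σ a_iℓ_i in X_9 with m ≥ 3 has m ≤ 9; effectivity of D is used only through the stated sign conditions on a and the a_i.) -/
/-- Part (i) of the lemma on `(-m)`-curves in `X₉`: if `D = a·h - ∑ aᵢ·lᵢ` is a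
`(-m)`-curve with `m ≥ 3` (the numerical conditions being `∑ aᵢ² = a² + m` and
`∑ aᵢ = 3a + m - 2`, and effectivity giving `a ≥ 0` and, when `a = 0`, `aᵢ ≤ 0`
for all `i`), then `m ≤ 9`. -/
theorem neg_m_curve_m_le_nine (m a : ℤ) (c : Fin 9 → ℤ)
    (hm : 3 ≤ m)
    (hsq : ∑ i, (c i) ^ 2 = a ^ 2 + m)
    (hsum : ∑ i, c i = 3 * a + m - 2)
    (ha : 0 ≤ a)
    (ha0 : a = 0 → ∀ i, c i ≤ 0) :
    m ≤ 9 := by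
  have ha1 : 1 ≤ a := by
    rcases ha.eq_or_lt with h | h
    · have hle : ∑ i, c i ≤ 0 := Finset.sum_nonpos fun i _ => ha0 h.symm i
      linarith
    · exact h
  have hcs : (∑ i, c i) ^ 2 ≤ 9 * ∑ i, (c i) ^ 2 := by
    simpa using sq_sum_le_card_mul_sum_sq (s := Finset.univ) (f := c)
  rw [hsum, hsq] at hcs
  nlinarith [mul_nonneg (sub_nonneg.2 ha1) (sub_nonneg.2 hm)]
end

section
/- Let m ≥ 3 be an integer and let a, a_1, …, a_9 be integers with a ≥ 0 satisfying a_1² + ⋯ + a_9² = a² + m and a_1 + ⋯ + a_9 = 3a + m − 2. Then a ≤ 3. (This is part (ii) of the paper's lemma on (−m)-curves: for a (−m)-curve D = a·h − Σ a_iℓ_i in X_9 with m ≥ 3 one has 0 ≤ a ≤ 3; in particular there is no such solution with m = 3 and a = 4.) -/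
/-- Part (ii) of the lemma on `(-m)`-curves in `X₉`: if `D = a·h - ∑ aᵢ·lᵢ` is a
`(-m)`-curve with `m ≥ 3` (numerically `∑ aᵢ² = a² + m`, `∑ aᵢ = 3a + m - 2`,
and `a ≥ 0`), then `a ≤ 3`. -/
theorem neg_m_curve_a_le_three (m a : ℤ) (c : Fin 9 → ℤ)
    (hm : 3 ≤ m)
    (ha : 0 ≤ a)
    (hsq : ∑ i, (c i) ^ 2 = a ^ 2 + m)
    (hsum : ∑ i, c i = 3 * a + m - 2) :
    a ≤ 3 := by
  have hCauchy : (3 * a + m - 2) ^ 2 ≤ 9 * (a ^ 2 + m) := by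
    have h := sq_sum_le_card_mul_sum_sq (s := Finset.univ) (f := c)
    simpa [hsum, hsq] using h
  by_contra! ha4
  -- Cauchy–Schwarz leaves only the case `a = 4`, `m = 3`.
  have hm3 : m = 3 := by nlinarith
  subst hm3
  have ha_eq : a = 4 := by nlinarith
  subst ha_eq
  have hnonneg : 0 ≤ ∑ i, (c i ^ 2 - 3 * c i + 2) := by
    refine Finset.sum_nonneg fun i _ => ?_
    rcases le_or_gt (c i) 1 with h | h <;> nlinarith
  rw [Finset.sum_add_distrib, Finset.sum_sub_distrib, ← Finset.mul_sum, hsq, hsum] at hnonneg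
  norm_num at hnonneg
end

section
/- Let m ≥ 3 be an integer and let a, a_1, …, a_9 be integers satisfying a_1² + ⋯ + a_9² = a² + m and a_1 + ⋯ + a_9 = 3a + m − 2. Assume a ≥ 0, and assume that if a = 0 then a_i ≤ 0 for every i. Then −1 ≤ a_i ≤ 2 for all i, and there exists an index j with a_j = 1. (This is part (iii) of the paper's lemma on (−m)-curves in X_9.) -/
/-- No integer lies strictly between `k` and `k + 1`. -/
theorem mul_sub_add_one_nonneg (x k : ℤ) : 0 ≤ (x - k) * (x - (k + 1)) := by
  rcases le_or_gt x k with h | h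
  · exact mul_nonneg_of_nonpos_of_nonpos (by omega) (by omega)
  · exact mul_nonneg (by omega) (by omega)

/-- An integer family with `∑ (c i - k) * (c i - (k + 1)) = 0` takes only the values `k`
and `k + 1`, since every summand is nonnegative. -/
theorem eq_or_eq_add_one_of_sum_eq_zero {ι : Type*} [Fintype ι] (c : ι → ℤ) (k : ℤ)
    (h : ∑ i, (c i - k) * (c i - (k + 1)) = 0) (i : ι) : c i = k ∨ c i = k + 1 := by
  have hi := (Finset.sum_eq_zero_iff_of_nonneg fun j _ => mul_sub_add_one_nonneg (c j) k).1 h i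
    (Finset.mem_univ i)
  rcases mul_eq_zero.1 hi with hi | hi <;> omega

/-- Part (iii) of the lemma on `(-m)`-curves in `X₉`: if `D = a·h - ∑ aᵢ·lᵢ` is a
`(-m)`-curve with `m ≥ 3` (numerically `∑ aᵢ² = a² + m`, `∑ aᵢ = 3a + m - 2`,
with `a ≥ 0` and, when `a = 0`, all `aᵢ ≤ 0`), then `-1 ≤ aᵢ ≤ 2` for all `i`
and some `aⱼ = 1`. -/
theorem neg_m_curve_coeff_bounds (m a : ℤ) (c : Fin 9 → ℤ)
    (hm : 3 ≤ m)
    (hsq : ∑ i, (c i) ^ 2 = a ^ 2 + m)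
    (hsum : ∑ i, c i = 3 * a + m - 2)
    (ha : 0 ≤ a)
    (ha0 : a = 0 → ∀ i, c i ≤ 0) :
    (∀ i, -1 ≤ c i ∧ c i ≤ 2) ∧ ∃ j, c j = 1 := by
  have key (k : ℤ) : ∑ i, (c i - k) * (c i - (k + 1)) =
      a ^ 2 + m - (2 * k + 1) * (3 * a + m - 2) + 9 * (k * (k + 1)) := by
    have expand (i : Fin 9) : (c i - k) * (c i - (k + 1)) =
        c i ^ 2 - (2 * k + 1) * c i + k * (k + 1) := by ring
    simp only [expand, Finset.sum_add_distrib, Finset.sum_sub_distrib, ← Finset.mul_sum, hsq, hsum]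
    simp
    ring
  have nonneg (k : ℤ) : 0 ≤ ∑ i, (c i - k) * (c i - (k + 1)) :=
    Finset.sum_nonneg fun i _ => mul_sub_add_one_nonneg (c i) k
  have a_pos : 1 ≤ a := by
    by_contra! h
    obtain rfl : a = 0 := by omega
    have := Finset.sum_nonpos fun i (_ : i ∈ Finset.univ) => ha0 rfl i
    omega
  have cauchy : (∑ i, c i) ^ 2 ≤ 9 * ∑ i, c i ^ 2 := by
    simpa using sq_sum_le_card_mul_sum_sq (s := Finset.univ) (f := c)
  rw [hsum, hsq] at cauchy
  have a_le : a ≤ 4 := by nlinarith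
  have h₁ := nonneg 1
  rw [key] at h₁
  have cases_a : a = 1 ∨ a = 2 ∨ (a = 3 ∧ m = 3) := by
    interval_cases a <;> omega
  rcases cases_a with ha | ha | ⟨rfl, rfl⟩
  case inr.inr =>
    have values := eq_or_eq_add_one_of_sum_eq_zero c 1 (by rw [key]; norm_num)
    refine ⟨fun i => by have := values i; omega, ?_⟩
    by_contra! h
    have two (i : Fin 9) : c i = 2 := by have := values i; have := h i; omega
    simp [two] at hsum
  all_goals
    have values := eq_or_eq_add_one_of_sum_eq_zero c 0 (by rw [key, ha]; ring)
    refine ⟨fun i => by have := values i; omega, ?_⟩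
    by_contra! h
    have zero (i : Fin 9) : c i = 0 := by have := values i; have := h i; omega
    simp [zero] at hsum
    omega
end

section
/- The set of elements D = a·h − Σ_{i=1}^9 a_i·l_i of ℤ^{1,9} for which there exists an integer m ≥ 3 with ⟨D,D⟩ = −m and ⟨D,K⟩ = m − 2, and which satisfy a ≥ 0 and (a = 0 → a_i ≤ 0 for all i), is finite. (This is part (iv) of the paper's lemma on (−m)-curves: there are only finitely many (−m)-curves with m ≥ 3 in X_9.) -/
/-- The intersection form on the Picard lattice `ℤ^{1,9}` of the blowup of `ℙ²`
at nine points, where an element `x : Fin 10 → ℤ` represents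
`x 0 · h + ∑ x (i+1) · lᵢ`; one has `⟨h,h⟩ = 1`, `⟨lᵢ,lᵢ⟩ = -1` and mixed
products vanish. -/
def interForm (x y : Fin 10 → ℤ) : ℤ :=
  x 0 * y 0 - ∑ i : Fin 9, x i.succ * y i.succ

/-- The canonical class `K = -3h + l₁ + ⋯ + l₉` of `X₉`. -/
def canK : Fin 10 → ℤ := fun i => if i = 0 then -3 else 1

/-- Part (iv) of the lemma on `(-m)`-curves in `X₉`: there are only finitely many
classes `D = a·h - ∑ aᵢ·lᵢ` (so `a = D 0` and `aᵢ = -(D i.succ)`) with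
`⟨D,D⟩ = -m` and `⟨D,K⟩ = m - 2` for some integer `m ≥ 3`, satisfying the
effectivity sign conditions `a ≥ 0` and (`a = 0 → aᵢ ≤ 0` for all `i`). -/
theorem neg_m_curves_finite :
    Set.Finite {D : Fin 10 → ℤ |
      (∃ m : ℤ, 3 ≤ m ∧ interForm D D = -m ∧ interForm D canK = m - 2) ∧
      0 ≤ D 0 ∧ (D 0 = 0 → ∀ i : Fin 9, -(D i.succ) ≤ 0)} := by
  refine (Set.finite_Icc (fun _ : Fin 10 => (-20 : ℤ)) (fun _ => 20)).subset ?_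
  rintro D ⟨⟨m, hm, hself, hcan⟩, ha, -⟩
  have hsq : ∑ i : Fin 9, D i.succ ^ 2 = D 0 ^ 2 + m := by
    simp only [interForm, ← sq] at hself
    linarith
  have hsum : ∑ i : Fin 9, D i.succ = -(3 * D 0 + m - 2) := by
    simp [interForm, canK] at hcan
    linarith
  have hcauchy : (∑ i : Fin 9, D i.succ) ^ 2 ≤ 9 * ∑ i : Fin 9, D i.succ ^ 2 := by
    simpa using sq_sum_le_card_mul_sum_sq (s := Finset.univ) (f := fun i : Fin 9 => D i.succ)
  rw [hsum, hsq] at hcauchy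
  have hprod : 0 ≤ D 0 * (m - 3) := mul_nonneg ha (by linarith)
  have hm_le : m ≤ 12 := by nlinarith
  have ha_le : D 0 ≤ 19 := by nlinarith [sq_nonneg (m - 2)]
  have hcoord (i : Fin 9) : D i.succ ^ 2 ≤ 20 ^ 2 := by
    have := Finset.single_le_sum (f := fun i : Fin 9 => D i.succ ^ 2)
      (fun i _ => sq_nonneg _) (Finset.mem_univ i)
    simp only [hsq] at this
    nlinarith
  have hbound (i : Fin 10) : -20 ≤ D i ∧ D i ≤ 20 := by
    refine Fin.cases ⟨by linarith, by linarith⟩ (fun j => ?_) i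
    exact abs_le.mp (abs_le_of_sq_le_sq (hcoord j) (by norm_num))
  exact ⟨fun i => (hbound i).1, fun i => (hbound i).2⟩
end
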